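/- arXiv:1906.11295 — 5 statements merged into one kernel-verified Lean document; each statement's English description precedes it below -/
import Mathlib

section
/- Let H be a hypergraph and s a positive integer. If there exists an s-trace of length k between hyperedges f and g, then there exists an s-meander of length at most k between f and g. -/
/-- A hypergraph is given by an indexed family `e : ι → Finset V` of hyperedges.
For a positive integer `s`, an `s`-walk of length `k` between the hyperedges (indexed by)
`f` and `g` is a sequence of hyperedge indices `w 0, w 1, …, w k` with `w 0 = f`, `w k = g`,
such that consecutive indices are distinct and consecutive hyperedges intersect in at
least `s` vertices. -/
def IsSWalk {V ι : Type*} [DecidableEq V] (e : ι → Finset V) (s k : ℕ)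
    (w : ℕ → ι) (f g : ι) : Prop :=
  w 0 = f ∧ w k = g ∧
    ∀ j, 1 ≤ j → j ≤ k → w (j - 1) ≠ w j ∧ s ≤ ((e (w (j - 1))) ∩ (e (w j))).card
/-- An `s`-trace is an `s`-walk whose hyperedge indices are pairwise distinct. -/
def IsSTrace {V ι : Type*} [DecidableEq V] (e : ι → Finset V) (s k : ℕ)
    (w : ℕ → ι) (f g : ι) : Prop :=
  IsSWalk e s k w f g ∧ ∀ x ≤ k, ∀ y ≤ k, x ≠ y → w x ≠ w y

/-- An `s`-meander is an `s`-trace whose successive intersections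
`I_j = e_{i_{j-1}} ∩ e_{i_j}` are pairwise distinct as sets. -/
def IsSMeander {V ι : Type*} [DecidableEq V] (e : ι → Finset V) (s k : ℕ)
    (w : ℕ → ι) (f g : ι) : Prop :=
  IsSTrace e s k w f g ∧
    ∀ x, 1 ≤ x → x ≤ k → ∀ y, 1 ≤ y → y ≤ k → x ≠ y →
      e (w (x - 1)) ∩ e (w x) ≠ e (w (y - 1)) ∩ e (w y)

/-- If the intersections `I_x = I_y` of an `s`-trace coincide for some `x < y`, the trace can be
shortened by jumping from `w (x - 1)` directly to `w y`. -/
theorem IsSTrace.shortcut {V ι : Type*} [DecidableEq V] {e : ι → Finset V}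
    {s k : ℕ} {w : ℕ → ι} {f g : ι} (h : IsSTrace e s k w f g) {x y : ℕ}
    (hx : 1 ≤ x) (hxy : x < y) (hy : y ≤ k)
    (hI : e (w (x - 1)) ∩ e (w x) = e (w (y - 1)) ∩ e (w y)) :
    IsSTrace e s (k - (y - x)) (fun n => w (if n < x then n else n + (y - x))) f g := by
  obtain ⟨⟨h0, hk, hw⟩, hd⟩ := h
  refine ⟨⟨?_, ?_, fun j hj hjk => ⟨?_, ?_⟩⟩, fun a ha b hb hab => ?_⟩
  · simpa [show 0 < x by omega] using h0
  · rw [← hk]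
    refine congrArg w ?_
    split_ifs <;> omega
  · apply hd <;> split_ifs <;> omega
  · rcases lt_trichotomy j x with hjx | rfl | hjx
    · simpa [hjx, show j - 1 < x by omega] using (hw j hj (by omega)).2
    · have hsub : e (w (j - 1)) ∩ e (w j) ⊆ e (w (j - 1)) ∩ e (w y) :=
        Finset.subset_inter Finset.inter_subset_left (hI ▸ Finset.inter_subset_right)
      simpa [show j - 1 < j by omega, show j + (y - j) = y by omega] using
        (hw j hj (by omega)).2.trans (Finset.card_le_card hsub)
    · have hcard := (hw (j + (y - x)) (by omega) (by omega)).2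
      rw [show j + (y - x) - 1 = j - 1 + (y - x) by omega] at hcard
      simpa [show ¬ j < x by omega, show ¬ j - 1 < x by omega] using hcard
  · apply hd <;> split_ifs <;> omega

/-- If there is an `s`-trace of length `k` between hyperedges `f` and `g`, then there is
an `s`-meander of length at most `k` between `f` and `g`. -/
theorem exists_isSMeander_of_isSTrace {V ι : Type*} [DecidableEq V] (e : ι → Finset V)
    (s : ℕ) (hs : 0 < s) (k : ℕ) (w : ℕ → ι) (f g : ι)
    (h : IsSTrace e s k w f g) :
    ∃ k' ≤ k, ∃ w' : ℕ → ι, IsSMeander e s k' w' f g := by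
  induction k using Nat.strong_induction_on generalizing w with
  | _ k ih =>
    by_cases hI : ∃ x y, 1 ≤ x ∧ x < y ∧ y ≤ k ∧
        e (w (x - 1)) ∩ e (w x) = e (w (y - 1)) ∩ e (w y)
    · obtain ⟨x, y, hx, hxy, hy, hI⟩ := hI
      obtain ⟨k', hk', w', hw'⟩ := ih _ (by omega) _ (h.shortcut hx hxy hy hI)
      exact ⟨k', by omega, w', hw'⟩
    · refine ⟨k, le_rfl, w, h, fun x hx hxk y hy hyk hxy heq => hI ?_⟩
      rcases lt_or_gt_of_ne hxy with hlt | hlt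
      · exact ⟨x, y, hx, hlt, hyk, heq⟩
      · exact ⟨y, x, hy, hlt, hxk, heq.symm⟩
end

section
/- Let H be a hypergraph and s a positive integer. If there exists an s-meander of length k between hyperedges f and g, then there exists an s-path of length at most k between f and g. -/
/-- An `s`-path is an `s`-meander in which no intersection is contained in another:
`I_x \\ I_y ≠ ∅` for all `x ≠ y`. -/
def IsSPath {V ι : Type*} [DecidableEq V] (e : ι → Finset V) (s k : ℕ)
    (w : ℕ → ι) (f g : ι) : Prop :=
  IsSMeander e s k w f g ∧
    ∀ x, 1 ≤ x → x ≤ k → ∀ y, 1 ≤ y → y ≤ k → x ≠ y →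
      ((e (w (x - 1)) ∩ e (w x)) \ (e (w (y - 1)) ∩ e (w y))).Nonempty

/-- A step from `w a` to `w b` with `a < b` may replace the part of an `s`-walk between them. -/
theorem IsSWalk.splice {V ι : Type*} [DecidableEq V] {e : ι → Finset V} {s k : ℕ}
    {w : ℕ → ι} {f g : ι} (h : IsSWalk e s k w f g) {a b : ℕ} (hab : a < b) (hbk : b ≤ k)
    (hne : w a ≠ w b) (hcard : s ≤ (e (w a) ∩ e (w b)).card) :
    IsSWalk e s (k - (b - a - 1)) (fun i => if i ≤ a then w i else w (i + (b - a - 1))) f g := by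
  obtain ⟨h0, hk, hstep⟩ := h
  refine ⟨by simpa using h0, ?_, fun j hj hjk => ?_⟩
  · have h1 : ¬ k - (b - a - 1) ≤ a := by omega
    have h2 : k - (b - a - 1) + (b - a - 1) = k := by omega
    simpa [h1, h2] using hk
  · rcases lt_trichotomy j (a + 1) with hlt | rfl | hgt
    · have h1 : j ≤ a := by omega
      have h2 : j - 1 ≤ a := by omega
      simp only [if_pos h1, if_pos h2]
      exact hstep j hj (by omega)
    · have h1 : a + 1 + (b - a - 1) = b := by omega
      simpa [h1] using And.intro hne hcard
    · have h1 : ¬ j ≤ a := by omega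
      have h2 : ¬ j - 1 ≤ a := by omega
      have h3 : j - 1 + (b - a - 1) = j + (b - a - 1) - 1 := by omega
      simp only [if_neg h1, if_neg h2, h3]
      exact hstep _ (by omega) (by omega)

/-- The indices of a shortest `s`-walk are pairwise distinct. -/
theorem IsSWalk.ne_of_minimal {V ι : Type*} [DecidableEq V] {e : ι → Finset V} {s k : ℕ}
    {w : ℕ → ι} {f g : ι} (h : IsSWalk e s k w f g)
    (hmin : ∀ m < k, ∀ w' : ℕ → ι, ¬ IsSWalk e s m w' f g)
    {x y : ℕ} (hxy : x < y) (hyk : y ≤ k) : w x ≠ w y := by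
  intro heq
  rcases hyk.eq_or_lt with rfl | hlt
  · exact hmin x hxy w ⟨h.1, heq.trans h.2.1, fun j hj hjx => h.2.2 j hj (by omega)⟩
  · have hstep := h.2.2 (y + 1) (by omega) hlt
    rw [Nat.add_sub_cancel, ← heq] at hstep
    exact hmin _ (by omega) _ (h.splice (a := x) (b := y + 1) (by omega) hlt hstep.1 hstep.2)

/-- In a shortest `s`-walk, fewer than `s` vertices lie in two hyperedges that are at least two
steps apart. -/
theorem IsSWalk.card_inter_lt_of_minimal {V ι : Type*} [DecidableEq V] {e : ι → Finset V}
    {s k : ℕ} {w : ℕ → ι} {f g : ι} (h : IsSWalk e s k w f g)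
    (hmin : ∀ m < k, ∀ w' : ℕ → ι, ¬ IsSWalk e s m w' f g)
    {a b : ℕ} (hab : a + 1 < b) (hbk : b ≤ k) : (e (w a) ∩ e (w b)).card < s := by
  by_contra! hcard
  exact hmin _ (by omega) _ (h.splice (by omega) hbk
    (h.ne_of_minimal hmin (by omega) hbk) hcard)

/-- A shortest `s`-walk is an `s`-path. -/
theorem IsSWalk.isSPath_of_minimal {V ι : Type*} [DecidableEq V] {e : ι → Finset V} {s k : ℕ}
    {w : ℕ → ι} {f g : ι} (h : IsSWalk e s k w f g)
    (hmin : ∀ m < k, ∀ w' : ℕ → ι, ¬ IsSWalk e s m w' f g) : IsSPath e s k w f g := by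
  have key : ∀ x, 1 ≤ x → x ≤ k → ∀ y, 1 ≤ y → y ≤ k → x ≠ y →
      ¬ e (w (x - 1)) ∩ e (w x) ⊆ e (w (y - 1)) ∩ e (w y) := by
    intro x hx hxk y hy hyk hxy hsub
    have hs := (h.2.2 x hx hxk).2
    rcases hxy.lt_or_gt with hlt | hgt
    · have hle := Finset.card_le_card
        (Finset.subset_inter Finset.inter_subset_left (hsub.trans Finset.inter_subset_right))
      have := h.card_inter_lt_of_minimal hmin (a := x - 1) (b := y) (by omega) hyk
      omega
    · have hle := Finset.card_le_card
        (Finset.subset_inter (hsub.trans Finset.inter_subset_left) Finset.inter_subset_right)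
      have := h.card_inter_lt_of_minimal hmin (a := y - 1) (b := x) (by omega) hxk
      omega
  refine ⟨⟨⟨h, fun x hx y hy hxy => ?_⟩, fun x hx hxk y hy hyk hxy heq =>
    key x hx hxk y hy hyk hxy heq.subset⟩, fun x hx hxk y hy hyk hxy =>
    Finset.sdiff_nonempty.2 (key x hx hxk y hy hyk hxy)⟩
  rcases hxy.lt_or_gt with hlt | hgt
  · exact h.ne_of_minimal hmin hlt hy
  · exact (h.ne_of_minimal hmin hgt hx).symm

/-- If there is an `s`-meander of length `k` between hyperedges `f` and `g`, then there
is an `s`-path of length at most `k` between `f` and `g`. -/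
theorem exists_isSPath_of_isSMeander {V ι : Type*} [DecidableEq V] (e : ι → Finset V)
    (s : ℕ) (hs : 0 < s) (k : ℕ) (w : ℕ → ι) (f g : ι)
    (h : IsSMeander e s k w f g) :
    ∃ k' ≤ k, ∃ w' : ℕ → ι, IsSPath e s k' w' f g := by
  classical
  have hex : ∃ m, ∃ w' : ℕ → ι, IsSWalk e s m w' f g := ⟨k, w, h.1.1⟩
  obtain ⟨w', hw'⟩ := Nat.find_spec hex
  exact ⟨Nat.find hex, Nat.find_min' hex ⟨w, h.1.1⟩, w',
    hw'.isSPath_of_minimal fun m hm v hv => Nat.find_min hex hm ⟨v, hv⟩⟩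
end

section
/- Let G be a finite simple graph and let G* be its dual hypergraph, whose vertices are the edges of G and which has, for each vertex x of G, a hyperedge x* = {e ∈ E(G) : x ∈ e}. Then for all vertices x, y of G, the graph distance between x and y in G equals the 1-distance between the hyperedges x* and y* in G*, where both distances are taken to be ∞ when no connecting walk exists. -/
/-- The `s`-distance between hyperedges: the length of a shortest `s`-walk,
or `∞` if no `s`-walk exists. -/
noncomputable def sDist {V ι : Type*} [DecidableEq V] (e : ι → Finset V) (s : ℕ)
    (f g : ι) : ℕ∞ :=
  sInf {n : ℕ∞ | ∃ k : ℕ, n = k ∧ ∃ w : ℕ → ι, IsSWalk e s k w f g}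

/-- The dual hypergraph `G*` of a simple graph `G`: its vertices are the edges of `G`,
and for each vertex `x` of `G` it has the hyperedge `x* = {e ∈ E(G) : x ∈ e}`,
indexed by the vertices of `G`. -/
def dualEdge {X : Type*} [Fintype X] [DecidableEq X] (G : SimpleGraph X)
    [DecidableRel G.Adj] (x : X) : Finset (Sym2 X) :=
  G.edgeFinset.filter (fun ed => x ∈ ed)

theorem ne_and_one_le_card_dualEdge_inter_iff {X : Type*} [Fintype X] [DecidableEq X]
    (G : SimpleGraph X) [DecidableRel G.Adj] (a b : X) :
    a ≠ b ∧ 1 ≤ (dualEdge G a ∩ dualEdge G b).card ↔ G.Adj a b := by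
  rw [Nat.one_le_iff_ne_zero, Finset.card_ne_zero]
  constructor
  · rintro ⟨hab, e, he⟩
    simp only [dualEdge, Finset.mem_inter, Finset.mem_filter, SimpleGraph.mem_edgeFinset] at he
    obtain ⟨⟨he, ha⟩, -, hb⟩ := he
    rwa [(Sym2.mem_and_mem_iff hab).1 ⟨ha, hb⟩, SimpleGraph.mem_edgeSet] at he
  · intro h
    exact ⟨h.ne, s(a, b), by simp [dualEdge, h]⟩

theorem exists_walk_length_eq_of_forall_adj {X : Type*} (G : SimpleGraph X) (w : ℕ → X) (k : ℕ)
    (h : ∀ j < k, G.Adj (w j) (w (j + 1))) : ∃ p : G.Walk (w 0) (w k), p.length = k := by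
  induction k with
  | zero => exact ⟨.nil, rfl⟩
  | succ k ih =>
    obtain ⟨p, hp⟩ := ih fun j hj => h j (by lia)
    exact ⟨p.concat (h k (by lia)), by simp [hp]⟩

theorem exists_isSWalk_one_dualEdge_iff {X : Type*} [Fintype X] [DecidableEq X]
    (G : SimpleGraph X) [DecidableRel G.Adj] (x y : X) (k : ℕ) :
    (∃ w, IsSWalk (dualEdge G) 1 k w x y) ↔ ∃ p : G.Walk x y, p.length = k := by
  simp only [IsSWalk, ne_and_one_le_card_dualEdge_inter_iff]
  constructor
  · rintro ⟨w, rfl, rfl, h⟩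
    exact exists_walk_length_eq_of_forall_adj G w k fun j hj => h (j + 1) (by lia) (by lia)
  · rintro ⟨p, rfl⟩
    refine ⟨p.getVert, p.getVert_zero, p.getVert_length, fun j h₁ h₂ => ?_⟩
    obtain ⟨i, rfl⟩ := Nat.exists_eq_add_of_le' h₁
    exact p.adj_getVert_succ h₂

/-- For a finite simple graph `G` with dual hypergraph `G*`, the graph distance between
vertices `x` and `y` of `G` equals the `1`-distance between the hyperedges `x*` and `y*`
of `G*` (both distances being `∞` when no connecting walk exists). -/
theorem graph_dist_eq_oneDist_dual {X : Type*} [Fintype X] [DecidableEq X]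
    (G : SimpleGraph X) [DecidableRel G.Adj] (x y : X) :
    G.edist x y = sDist (dualEdge G) 1 x y := by
  simp only [sDist, exists_isSWalk_one_dualEdge_iff]
  apply le_antisymm
  · refine le_sInf ?_
    rintro _ ⟨_, rfl, p, rfl⟩
    exact SimpleGraph.edist_le p
  · exact le_iInf fun p => sInf_le ⟨p.length, rfl, p, rfl⟩
end

section
/- Let H be a hypergraph with finitely many vertices and finitely many hyperedges. Then the number of 1-connected components of H (equivalence classes of nonempty hyperedges of H under the relation of being joined by a 1-walk) equals the number of 1-connected components of the dual hypergraph H* (equivalence classes of the nonempty hyperedges v* of H*, i.e., of the vertices of H having positive degree, under the relation of being joined by a 1-walk in H*). -/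
/-- The dual hypergraph of `e : ι → Finset V`: for each vertex `v` of `H`, the
hyperedge `v* = {i : v ∈ e i}` of `H*`, indexed by the vertices of `H`. -/
def dualFam {V ι : Type*} [Fintype ι] [DecidableEq ι] (e : ι → Finset V)
    [∀ v i, Decidable (v ∈ e i)] (v : V) : Finset ι :=
  Finset.univ.filter (fun i => v ∈ e i)

open Relation in
/-- Two hyperedges are joined by a `1`-walk if and only if they are related by the reflexive
transitive closure of the relation of having a common vertex. -/
theorem exists_isSWalk_one_iff {V ι : Type*} [DecidableEq V] (e : ι → Finset V) (f g : ι) :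
    (∃ (k : ℕ) (w : ℕ → ι), IsSWalk e 1 k w f g) ↔
      ReflTransGen (fun i j => ∃ v, v ∈ e i ∧ v ∈ e j) f g := by
  constructor
  · rintro ⟨k, w, rfl, rfl, hw⟩
    have h : ∀ n ≤ k, ReflTransGen (fun i j => ∃ v, v ∈ e i ∧ v ∈ e j) (w 0) (w n) := by
      intro n hn
      induction n with
      | zero => exact .refl
      | succ n ih =>
        refine (ih (by omega)).tail ?_
        obtain ⟨v, hv⟩ := Finset.card_pos.1 (hw (n + 1) (by omega) hn).2
        exact ⟨v, by simpa using hv⟩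
    exact h k le_rfl
  · intro h
    induction h with
    | refl => exact ⟨0, fun _ => f, rfl, rfl, by intros; omega⟩
    | @tail i j _ hij ih =>
      obtain ⟨k, w, h0, hk, hw⟩ := ih
      obtain ⟨v, hvi, hvj⟩ := hij
      by_cases hne : i = j
      · exact ⟨k, w, h0, hne ▸ hk, hw⟩
      refine ⟨k + 1, fun n => if n ≤ k then w n else j, by simpa using h0, by simp, ?_⟩
      intro n h1 hn
      rcases Nat.lt_or_ge k n with hlt | hle
      · obtain rfl : n = k + 1 := by omega
        have hinter : (e i ∩ e j).Nonempty := ⟨v, Finset.mem_inter.2 ⟨hvi, hvj⟩⟩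
        simpa [hk] using ⟨hne, hinter⟩
      · simpa [hle, (Nat.sub_le n 1).trans hle] using hw n h1 hle

/-- The class of `i` under the equivalence closure of having a common `r`-neighbour. -/
def incidenceComponent {α β : Type*} (r : α → β → Prop) (i : α) : Set α :=
  {j | Relation.ReflTransGen (fun a b => ∃ v, r a v ∧ r b v) i j}

/-- The `r`-neighbourhood of the component of `i` is the dual component of any `r`-neighbour
of `i`. -/
theorem neighbors_incidenceComponent {α β : Type*} {r : α → β → Prop} {i : α} {v : β}
    (h : r i v) :
    {u | ∃ j ∈ incidenceComponent r i, r j u} = incidenceComponent (flip r) v := by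
  ext u
  constructor
  · rintro ⟨j, hij, hju⟩
    induction hij generalizing u with
    | refl => exact .single ⟨i, h, hju⟩
    | @tail j k _ hjk ih =>
      obtain ⟨w, hjw, hkw⟩ := hjk
      exact (ih w hjw).tail ⟨k, hkw, hju⟩
  · intro hvu
    induction hvu with
    | refl => exact ⟨i, .refl, h⟩
    | @tail u u' _ huu' ih =>
      obtain ⟨j, hij, hju⟩ := ih
      obtain ⟨k, hku, hku'⟩ := huu'
      exact ⟨k, hij.tail ⟨u, hju, hku⟩, hku'⟩

/-- The components on the two sides of an incidence relation are equinumerous. -/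
theorem ncard_incidenceComponents_eq_flip {α β : Type*} (r : α → β → Prop) :
    {C | ∃ i, (∃ v, r i v) ∧ C = incidenceComponent r i}.ncard =
      {C | ∃ v, (∃ i, r i v) ∧ C = incidenceComponent (flip r) v}.ncard := by
  have hflip {i : α} {v : β} (h : r i v) :
      {j | ∃ u ∈ incidenceComponent (flip r) v, r j u} = incidenceComponent r i :=
    neighbors_incidenceComponent (r := flip r) h
  refine Set.BijOn.ncard_eq (f := fun C => {u | ∃ j ∈ C, r j u})
    (Set.InvOn.bijOn (f' := fun D => {j | ∃ u ∈ D, r j u}) ⟨?_, ?_⟩ ?_ ?_)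
  · rintro _ ⟨i, ⟨v, h⟩, rfl⟩
    simp only [neighbors_incidenceComponent h, hflip h]
  · rintro _ ⟨v, ⟨i, h⟩, rfl⟩
    simp only [hflip h, neighbors_incidenceComponent h]
  · rintro _ ⟨i, ⟨v, h⟩, rfl⟩
    exact ⟨v, ⟨i, h⟩, neighbors_incidenceComponent h⟩
  · rintro _ ⟨v, ⟨i, h⟩, rfl⟩
    exact ⟨i, ⟨v, h⟩, hflip h⟩

/-- The number of `1`-connected components of a finite hypergraph `H` (equivalence
classes of nonempty hyperedges under the relation of being joined by a `1`-walk)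
equals the number of `1`-connected components of its dual hypergraph `H*`
(equivalence classes of the nonempty hyperedges `v*` of `H*`, i.e. of the vertices of
`H` of positive degree, under being joined by a `1`-walk in `H*`). -/
theorem card_oneComponents_eq_card_oneComponents_dual {V ι : Type*} [Fintype V]
    [Fintype ι] [DecidableEq V] [DecidableEq ι] (e : ι → Finset V)
    [∀ v i, Decidable (v ∈ e i)] :
    {C : Set ι | ∃ i : ι, (e i).Nonempty ∧
        C = {j : ι | ∃ (k : ℕ) (w : ℕ → ι), IsSWalk e 1 k w i j}}.ncard =
    {C : Set V | ∃ v : V, (dualFam e v).Nonempty ∧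
        C = {u : V | ∃ (k : ℕ) (w : ℕ → V), IsSWalk (dualFam e) 1 k w v u}}.ncard := by
  simp only [exists_isSWalk_one_iff]
  simpa [Finset.Nonempty, dualFam, incidenceComponent, flip] using
    ncard_incidenceComponents_eq_flip (fun i v => v ∈ e i)
end

section
/- Let H be a hypergraph and s a positive integer. If hyperedges e_1, e_2, e_3 of H (with pairwise distinct indices) form an s-triangle, i.e., the sequence e_1, e_2, e_3, e_1 is a closed s-path of length 3, then there exist three pairwise distinct vertices v_1, v_2, v_3 of H such that v_1, v_2 ∈ e_2 ∩ {e_1 or as follows}: v_1 ∈ e_1 ∩ e_2, v_2 ∈ e_2 ∩ e_3, and v_3 ∈ e_3 ∩ e_1; in particular e_1 contains the two distinct vertices v_1, v_3, e_2 contains v_1, v_2, and e_3 contains v_2, v_3, so H contains a hypertriangle in the sense of Estrada (a 6-cycle in the bipartite representation of H). -/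
/-- A closed `s`-walk: an `s`-walk of length `k` from `w 0` back to `w 0`. -/
def IsClosedSWalk {V ι : Type*} [DecidableEq V] (e : ι → Finset V) (s k : ℕ)
    (w : ℕ → ι) : Prop :=
  IsSWalk e s k w (w 0) (w 0)

/-- A closed `s`-trace: a closed `s`-walk whose indices `w 0, …, w (k-1)` are pairwise
distinct (only the terminal index, which repeats the initial one, is exempt). -/
def IsClosedSTrace {V ι : Type*} [DecidableEq V] (e : ι → Finset V) (s k : ℕ)
    (w : ℕ → ι) : Prop :=
  IsClosedSWalk e s k w ∧ ∀ x < k, ∀ y < k, x ≠ y → w x ≠ w y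

/-- A closed `s`-path: a closed `s`-trace whose intersections are pairwise distinct
and none of which is contained in another. An `s`-triangle is a closed `s`-path of
length 3. -/
def IsClosedSPath {V ι : Type*} [DecidableEq V] (e : ι → Finset V) (s k : ℕ)
    (w : ℕ → ι) : Prop :=
  IsClosedSTrace e s k w ∧
    (∀ x, 1 ≤ x → x ≤ k → ∀ y, 1 ≤ y → y ≤ k → x ≠ y →
      e (w (x - 1)) ∩ e (w x) ≠ e (w (y - 1)) ∩ e (w y)) ∧
    (∀ x, 1 ≤ x → x ≤ k → ∀ y, 1 ≤ y → y ≤ k → x ≠ y →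
      ((e (w (x - 1)) ∩ e (w x)) \ (e (w (y - 1)) ∩ e (w y))).Nonempty)

/-- If hyperedges `a, b, c` (pairwise distinct indices) form an `s`-triangle, i.e. the
sequence `a, b, c, a` is a closed `s`-path of length 3, then there are three pairwise
distinct vertices `v₁ ∈ e a ∩ e b`, `v₂ ∈ e b ∩ e c`, `v₃ ∈ e c ∩ e a`; in particular
`H` contains a hypertriangle in the sense of Estrada (a 6-cycle in the bipartite
representation of `H`). -/
theorem sTriangle_hypertriangle {V ι : Type*} [DecidableEq V] (e : ι → Finset V)
    (s : ℕ) (hs : 0 < s) (a b c : ι) (hab : a ≠ b) (hbc : b ≠ c) (hca : c ≠ a)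
    (w : ℕ → ι) (hw0 : w 0 = a) (hw1 : w 1 = b) (hw2 : w 2 = c)
    (h : IsClosedSPath e s 3 w) :
    ∃ v₁ v₂ v₃ : V, v₁ ≠ v₂ ∧ v₂ ≠ v₃ ∧ v₁ ≠ v₃ ∧
      v₁ ∈ e a ∩ e b ∧ v₂ ∈ e b ∩ e c ∧ v₃ ∈ e c ∩ e a := by
  have hw3 : w 3 = a := h.1.1.2.1.trans hw0
  obtain ⟨v₁, h₁⟩ := h.2.2 1 (by norm_num) (by norm_num) 2 (by norm_num) (by norm_num)
    (by norm_num)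
  obtain ⟨v₂, h₂⟩ := h.2.2 2 (by norm_num) (by norm_num) 3 (by norm_num) (by norm_num)
    (by norm_num)
  obtain ⟨v₃, h₃⟩ := h.2.2 3 (by norm_num) (by norm_num) 1 (by norm_num) (by norm_num)
    (by norm_num)
  norm_num [hw0, hw1, hw2, hw3] at h₁ h₂ h₃
  refine ⟨v₁, v₂, v₃, ?_, ?_, ?_, ?_, ?_, ?_⟩ <;> grind
end
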